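/- Let n ≥ 3, let α, β, γ, ν be real numbers and 1 < p < ∞. If the operator S = S_{α,β,γ} is bounded from L^p_ν(Λ_n) into L^∞(Λ_n), then the parameters satisfy: (i) γ = α + β + n/2 − ν/p; (ii) ν < p(β + 1) + n/2 − 1; (iii) p(α − n/2 + 1) > −n/2 + 1. (This is the necessity lemma, Lemma 4.6 of the paper, instantiated on the rank-2 Lorentz cone, where n/r = n/2.) -/

import Mathlib

open MeasureTheory ENNReal

noncomputable section

/-- The Lorentz determinant `Δ(y) = y₁² − y₂² − ⋯ − y_n²`. -/
def lDelta (n : ℕ) [NeZero n] (y : Fin n → ℝ) : ℝ :=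
  2 * y 0 ^ 2 - ∑ i, y i ^ 2

/-- The Lorentz cone `Λ_n`. -/
def lCone (n : ℕ) [NeZero n] : Set (Fin n → ℝ) :=
  {y | 0 < lDelta n y ∧ 0 < y 0}

/-- The `L^p_ν(Λ_n)` norm `(∫_{Λ_n} |g(y)|^p Δ(y)^{ν−n/2} dy)^{1/p}`. -/
def coneNorm (n : ℕ) [NeZero n] (p ν : ℝ) (g : (Fin n → ℝ) → ℝ) : ℝ≥0∞ :=
  (∫⁻ y in lCone n, ENNReal.ofReal (|g y| ^ p * lDelta n y ^ (ν - (n : ℝ) / 2))) ^ (1 / p)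

/-- The operator `S_{α,β,γ}` applied to `|g|`:
`S|g|(y) = Δ(y)^α ∫_{Λ_n} Δ(y+x)^{−γ} |g(x)| Δ(x)^β dx`. -/
def Sop (n : ℕ) [NeZero n] (α β γ : ℝ) (g : (Fin n → ℝ) → ℝ) (y : Fin n → ℝ) : ℝ≥0∞ :=
  ENNReal.ofReal (lDelta n y ^ α) *
    ∫⁻ x in lCone n, ENNReal.ofReal (lDelta n (y + x) ^ (-γ) * |g x| * lDelta n x ^ β)

/-- The `L^q_μ(Λ_n)` norm of `S_{α,β,γ}|g|`. -/
def SopNorm (n : ℕ) [NeZero n] (α β γ q μ : ℝ) (g : (Fin n → ℝ) → ℝ) : ℝ≥0∞ :=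
  (∫⁻ y in lCone n, Sop n α β γ g y ^ q * ENNReal.ofReal (lDelta n y ^ (μ - (n : ℝ) / 2))) ^ (1 / q)

/-- `S_{α,β,γ}` is bounded from `L^p_ν(Λ_n)` to `L^q_μ(Λ_n)`:
`‖S|g|‖_{q,μ} ≤ C ‖g‖_{p,ν}` for every `g ∈ L^p_ν(Λ_n)`. -/
def SBounded (n : ℕ) [NeZero n] (α β γ p ν q μ : ℝ) : Prop :=
  ∃ C > (0 : ℝ), ∀ g : (Fin n → ℝ) → ℝ, Measurable g → coneNorm n p ν g < ⊤ →
    SopNorm n α β γ q μ g ≤ ENNReal.ofReal C * coneNorm n p ν g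

/-- `S_{α,β,γ}` is bounded from `L^p_ν(Λ_n)` to `L^∞(Λ_n)`:
`sup_{y∈Λ_n} S|g|(y) ≤ C ‖g‖_{p,ν}` for every `g ∈ L^p_ν(Λ_n)`. -/
def SBoundedSup (n : ℕ) [NeZero n] (α β γ p ν : ℝ) : Prop :=
  ∃ C > (0 : ℝ), ∀ g : (Fin n → ℝ) → ℝ, Measurable g → coneNorm n p ν g < ⊤ →
    ∀ y ∈ lCone n, Sop n α β γ g y ≤ ENNReal.ofReal C * coneNorm n p ν g

/-- Comparable positive numbers have comparable real powers. -/
lemma exists_pos_mul_rpow_le (s A B : ℝ) (hA : 0 < A) :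
    ∃ c > 0, ∀ X Y : ℝ, 0 < Y → A * Y ≤ X → X ≤ B * Y → c * Y ^ s ≤ X ^ s := by
  by_cases hs : 0 ≤ s
  · refine ⟨A ^ s, by positivity, fun X Y hY h1 _ => ?_⟩
    rw [← Real.mul_rpow hA.le hY.le]
    exact Real.rpow_le_rpow (by positivity) h1 hs
  · by_cases hB : 0 < B
    · refine ⟨B ^ s, by positivity, fun X Y hY h1 h2 => ?_⟩
      rw [← Real.mul_rpow hB.le hY.le]
      exact Real.rpow_le_rpow_of_nonpos (lt_of_lt_of_le (by positivity) h1) h2 (by linarith)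
    · refine ⟨1, one_pos, fun X Y hY h1 h2 => ?_⟩
      have h3 : 0 < A * Y := by positivity
      have h4 : B * Y ≤ 0 := mul_nonpos_of_nonpos_of_nonneg (not_lt.1 hB) hY.le
      linarith

lemma continuous_lDelta (n : ℕ) [NeZero n] : Continuous (lDelta n) := by
  unfold lDelta
  fun_prop

lemma measurableSet_lCone (n : ℕ) [NeZero n] : MeasurableSet (lCone n) :=
  ((isOpen_lt continuous_const (continuous_lDelta n)).inter
    (isOpen_lt continuous_const (continuous_apply 0))).measurableSet

lemma lDelta_smul (n : ℕ) [NeZero n] (τ : ℝ) (y : Fin n → ℝ) :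
    lDelta n (τ • y) = τ ^ 2 * lDelta n y := by
  simp only [lDelta, Pi.smul_apply, smul_eq_mul, mul_pow, ← Finset.mul_sum]
  ring

lemma smul_mem_lCone {n : ℕ} [NeZero n] {τ : ℝ} (hτ : 0 < τ) {y : Fin n → ℝ} :
    τ • y ∈ lCone n ↔ y ∈ lCone n := by
  simp only [lCone, Set.mem_ofPred_eq, lDelta_smul, Pi.smul_apply, smul_eq_mul]
  rw [mul_pos_iff_of_pos_left (by positivity), mul_pos_iff_of_pos_left hτ]

lemma lDelta_cons (m : ℕ) (u : ℝ) (z : Fin m → ℝ) :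
    lDelta (m + 1) (Fin.cons u z) = u ^ 2 - ∑ i, z i ^ 2 := by
  simp only [lDelta, Fin.sum_univ_succ, Fin.cons_zero, Fin.cons_succ]
  ring

/-- The sum of two elements of the Lorentz cone lies in the cone. -/
lemma add_mem_lCone {n : ℕ} [NeZero n] {x y : Fin n → ℝ} (hx : x ∈ lCone n) (hy : y ∈ lCone n) :
    x + y ∈ lCone n := by
  obtain ⟨m, rfl⟩ := Nat.exists_eq_succ_of_ne_zero (NeZero.ne n)
  obtain ⟨u, z, rfl⟩ : ∃ u z, x = Fin.cons u z := ⟨_, _, (Fin.cons_self_tail x).symm⟩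
  obtain ⟨v, w, rfl⟩ : ∃ v w, y = Fin.cons v w := ⟨_, _, (Fin.cons_self_tail y).symm⟩
  have hadd : (Fin.cons u z + Fin.cons v w : Fin (m + 1) → ℝ) = Fin.cons (u + v) (z + w) := by
    ext i
    refine Fin.cases ?_ (fun j => ?_) i <;> simp
  rw [hadd]
  simp only [lCone, Set.mem_ofPred_eq, lDelta_cons, Nat.succ_eq_add_one, Fin.cons_zero] at hx hy ⊢
  refine ⟨?_, by linarith [hx.2, hy.2]⟩
  have h := Finset.sum_mul_sq_le_sq_mul_sq Finset.univ z w
  have h1 : ∑ i, z i * w i < u * v := by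
    refine lt_of_pow_lt_pow_left₀ 2 (by nlinarith [hx.2, hy.2]) (h.trans_lt ?_)
    rw [mul_pow]
    exact mul_lt_mul'' (by linarith [hx.1]) (by linarith [hy.1])
      (Finset.sum_nonneg fun _ _ => sq_nonneg _) (Finset.sum_nonneg fun _ _ => sq_nonneg _)
  have h2 : ∑ i, (z + w) i ^ 2 = ∑ i, z i ^ 2 + 2 * ∑ i, z i * w i + ∑ i, w i ^ 2 := by
    rw [Finset.mul_sum, ← Finset.sum_add_distrib, ← Finset.sum_add_distrib]
    refine Finset.sum_congr rfl fun i _ => ?_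
    simp only [Pi.add_apply]
    ring
  nlinarith [hx.1, hy.1]

/-- The beta-type integral `∫_{Λ_n} Δ(y+x)^{−t} Δ(x)^a dx`. -/
def coneBeta (n : ℕ) [NeZero n] (a t : ℝ) (y : Fin n → ℝ) : ℝ≥0∞ :=
  ∫⁻ x in lCone n, ENNReal.ofReal (lDelta n (y + x) ^ (-t) * lDelta n x ^ a)

lemma coneBeta_smul (n : ℕ) [NeZero n] (a t : ℝ) {τ : ℝ} (hτ : 0 < τ) {y : Fin n → ℝ}
    (hy : y ∈ lCone n) :
    coneBeta n a t (τ • y) = ENNReal.ofReal (τ ^ (2 * a - 2 * t + n)) * coneBeta n a t y := by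
  have hmap : (volume : Measure (Fin n → ℝ)) =
      ENNReal.ofReal (τ ^ n) • Measure.map (τ • ·) volume := by
    rw [Measure.map_addHaar_smul _ hτ.ne', smul_smul, ← ENNReal.ofReal_mul (by positivity),
      Module.finrank_fin_fun, abs_of_pos (by positivity), mul_inv_cancel₀ (by positivity)]
    simp
  have hΔ : Measurable (lDelta n) := (continuous_lDelta n).measurable
  unfold coneBeta
  conv_lhs => rw [hmap]
  rw [← lintegral_indicator (measurableSet_lCone n), ← lintegral_indicator (measurableSet_lCone n),
    lintegral_smul_measure, lintegral_map _ (measurable_const_smul τ), smul_eq_mul,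
    ← lintegral_const_mul' _ _ ENNReal.ofReal_ne_top,
    ← lintegral_const_mul' _ _ ENNReal.ofReal_ne_top]
  · refine lintegral_congr fun x => ?_
    by_cases hx : x ∈ lCone n
    · have h1 : 0 < lDelta n (y + x) := (add_mem_lCone hy hx).1
      have h2 : 0 < lDelta n x := hx.1
      rw [Set.indicator_of_mem hx, Set.indicator_of_mem ((smul_mem_lCone hτ).2 hx), ← smul_add,
        lDelta_smul, lDelta_smul, ← ENNReal.ofReal_mul (by positivity),
        ← ENNReal.ofReal_mul (by positivity), Real.mul_rpow (by positivity) h1.le,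
        Real.mul_rpow (by positivity) h2.le, ← Real.rpow_natCast, ← Real.rpow_natCast,
        ← Real.rpow_mul hτ.le, ← Real.rpow_mul hτ.le]
      congr 1
      have : τ ^ (2 * a - 2 * t + n) =
          τ ^ (n : ℝ) * (τ ^ (((2 : ℕ) : ℝ) * -t) * τ ^ (((2 : ℕ) : ℝ) * a)) := by
        rw [← Real.rpow_add hτ, ← Real.rpow_add hτ]
        congr 1
        push_cast
        ring
      rw [this]
      ring
    · rw [Set.indicator_of_notMem hx, Set.indicator_of_notMem (mt (smul_mem_lCone hτ).1 hx)]
      simp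
  · refine Measurable.indicator ?_ (measurableSet_lCone n)
    exact (((hΔ.comp (measurable_const_add _)).pow_const _).mul (hΔ.pow_const _)).ennreal_ofReal

/-- Testing the operator on the extremal functions of Hölder's inequality. -/
lemma coneBeta_le_of_sBoundedSup (n : ℕ) [NeZero n] {α β γ ν p : ℝ} (hp : 1 < p)
    (hS : SBoundedSup n α β γ p ν) :
    ∃ D : ℝ, ∀ y ∈ lCone n,
      coneBeta n (β * (p / (p - 1)) - (ν - n / 2) * (1 / (p - 1))) (γ * (p / (p - 1))) y ≤
        ENNReal.ofReal (D * lDelta n y ^ (-α * (p / (p - 1)))) := by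
  obtain ⟨C, hC, hS⟩ := hS
  have hp1 : 0 < p - 1 := by linarith
  set a := β * (p / (p - 1)) - (ν - n / 2) * (1 / (p - 1)) with ha
  set t := γ * (p / (p - 1)) with ht
  refine ⟨C ^ (p / (p - 1)), fun y hy => ?_⟩
  set h : (Fin n → ℝ) → ℝ := fun x => lDelta n (y + x) ^ (-t) * lDelta n x ^ a with hh
  have hΔ : Measurable (lDelta n) := (continuous_lDelta n).measurable
  have hhm : Measurable h := by
    simp only [hh]
    exact ((hΔ.comp (measurable_const_add y)).pow_const _).mul (hΔ.pow_const _)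
  set E : ℕ → Set (Fin n → ℝ) := fun m => lCone n ∩ {x | ‖x‖ ≤ m ∧ h x ≤ m} with hE
  have hEm : ∀ m, MeasurableSet (E m) := fun m =>
    (measurableSet_lCone n).inter ((measurableSet_le measurable_norm measurable_const).inter
      (measurableSet_le hhm measurable_const))
  have hEU : ⋃ m, E m = lCone n := by
    refine Set.Subset.antisymm (Set.iUnion_subset fun m => Set.inter_subset_left) fun x hx => ?_
    obtain ⟨m, hm⟩ := exists_nat_ge (max ‖x‖ (h x))
    exact Set.mem_iUnion.2 ⟨m, hx, (le_max_left _ _).trans hm, (le_max_right _ _).trans hm⟩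
  have hEd : Directed (· ⊆ ·) E := by
    refine Monotone.directed_le fun i j hij x hx => ?_
    have : (i : ℝ) ≤ j := by exact_mod_cast hij
    exact ⟨hx.1, hx.2.1.trans this, hx.2.2.trans this⟩
  have hpos : ∀ x ∈ lCone n, 0 < lDelta n (y + x) ∧ 0 < lDelta n x := fun x hx =>
    ⟨(add_mem_lCone hy hx).1, hx.1⟩
  unfold coneBeta
  rw [← hEU, setLIntegral_iUnion_of_directed _ hEd]
  refine iSup_le fun m => ?_
  set I := ∫⁻ x in E m, ENNReal.ofReal (h x) with hI
  have hIfin : I ≠ ⊤ := by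
    refine ne_top_of_le_ne_top (b := ENNReal.ofReal m * volume (E m)) ?_ ?_
    · refine ENNReal.mul_ne_top ENNReal.ofReal_ne_top (ne_top_of_le_ne_top
        (measure_closedBall_lt_top (x := (0 : Fin n → ℝ)) (r := m)).ne
        (measure_mono fun x hx => ?_))
      simpa using hx.2.1
    · rw [← setLIntegral_const]
      exact setLIntegral_mono' (hEm m) fun x hx => ENNReal.ofReal_le_ofReal hx.2.2
  set g : (Fin n → ℝ) → ℝ := (E m).indicator fun x =>
    lDelta n (y + x) ^ (-γ * (1 / (p - 1))) * lDelta n x ^ ((β - (ν - n / 2)) * (1 / (p - 1)))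
    with hg
  have hgm : Measurable g := by
    refine Measurable.indicator ?_ (hEm m)
    exact ((hΔ.comp (measurable_const_add y)).pow_const _).mul (hΔ.pow_const _)
  have hEsub : E m ⊆ lCone n := Set.inter_subset_left
  have hnorm : coneNorm n p ν g = I ^ (1 / p) := by
    unfold coneNorm
    congr 1
    rw [hI, ← lintegral_indicator (measurableSet_lCone n), ← lintegral_indicator (hEm m)]
    congr 1
    ext x
    by_cases hx : x ∈ E m
    · obtain ⟨h1, h2⟩ := hpos x (hEsub hx)
      rw [Set.indicator_of_mem (hEsub hx), Set.indicator_of_mem hx, hg, Set.indicator_of_mem hx,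
        abs_of_pos (by positivity), Real.mul_rpow (by positivity) (by positivity),
        ← Real.rpow_mul h1.le, ← Real.rpow_mul h2.le, mul_assoc, ← Real.rpow_add h2]
      congr 3
      · rw [ht]; ring
      · rw [ha]; field_simp; ring
    · classical
      have hgx : g x = 0 := Set.indicator_of_notMem hx _
      rw [Set.indicator_of_notMem hx, Set.indicator_apply]
      simp [hgx, Real.zero_rpow (by linarith : p ≠ 0)]
  have hSop : Sop n α β γ g y = ENNReal.ofReal (lDelta n y ^ α) * I := by
    unfold Sop
    congr 1
    rw [hI, ← lintegral_indicator (measurableSet_lCone n), ← lintegral_indicator (hEm m)]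
    congr 1
    ext x
    by_cases hx : x ∈ E m
    · obtain ⟨h1, h2⟩ := hpos x (hEsub hx)
      rw [Set.indicator_of_mem (hEsub hx), Set.indicator_of_mem hx, hg, Set.indicator_of_mem hx,
        abs_of_pos (by positivity), ← mul_assoc, ← Real.rpow_add h1, mul_assoc,
        ← Real.rpow_add h2]
      congr 3
      · rw [ht]; field_simp; ring
      · rw [ha]; field_simp; ring
    · classical
      have hgx : g x = 0 := Set.indicator_of_notMem hx _
      rw [Set.indicator_of_notMem hx, Set.indicator_apply]
      simp [hgx]
  have key := hS g hgm
    (by rw [hnorm]; exact ENNReal.rpow_lt_top_of_nonneg (by positivity) hIfin) y hy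
  rw [hnorm, hSop] at key
  obtain ⟨J, hJ, hIJ⟩ : ∃ J : ℝ, 0 ≤ J ∧ I = ENNReal.ofReal J :=
    ⟨I.toReal, ENNReal.toReal_nonneg, (ENNReal.ofReal_toReal hIfin).symm⟩
  have hd : 0 < lDelta n y := hy.1
  rw [hIJ, ENNReal.ofReal_rpow_of_nonneg hJ (by positivity), ← ENNReal.ofReal_mul (by positivity),
    ← ENNReal.ofReal_mul hC.le, ENNReal.ofReal_le_ofReal_iff (by positivity)] at key
  rw [hIJ]
  refine ENNReal.ofReal_le_ofReal ?_
  rcases hJ.eq_or_lt with rfl | hJ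
  · positivity
  rw [Real.rpow_mul hd.le, ← Real.mul_rpow hC.le (by positivity)]
  have hJ1 : J = (J ^ (1 - 1 / p)) ^ (p / (p - 1)) := by
    rw [← Real.rpow_mul hJ.le]
    conv_lhs => rw [← Real.rpow_one J]
    congr 1
    field_simp
  rw [hJ1]
  refine Real.rpow_le_rpow (by positivity) ?_ (by positivity)
  rw [Real.rpow_sub hJ, Real.rpow_one, Real.rpow_neg hd.le, div_le_iff₀ (by positivity)]
  rw [mul_assoc, inv_mul_eq_div, mul_div_assoc', le_div_iff₀ (by positivity)]
  linarith

/-- Near the boundary of the cone, at all scales, `coneBeta` dominates a product of two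
radial integrals. -/
lemma exists_mul_le_coneBeta (m : ℕ) (hm : 0 < m) (a t : ℝ) :
    ∃ c : ℝ, 0 < c ∧
      ENNReal.ofReal c * (∫⁻ z in {z : Fin m → ℝ | 1 < ‖z‖}, ENNReal.ofReal (‖z‖ ^ (a - t))) *
        (∫⁻ s in Set.Ioo (0 : ℝ) 1, ENNReal.ofReal (s ^ a)) ≤
      coneBeta (m + 1) a t (Fin.cons 1 0) := by
  have hm1 : (1 : ℝ) ≤ m := by exact_mod_cast hm
  obtain ⟨c₁, hc₁, h₁⟩ := exists_pos_mul_rpow_le (-t) 1 (8 * m) one_pos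
  obtain ⟨c₂, hc₂, h₂⟩ := exists_pos_mul_rpow_le a 1 (3 * m) one_pos
  refine ⟨c₁ * c₂, by positivity, ?_⟩
  set r : (Fin m → ℝ) → ℝ := fun z => √(∑ i, z i ^ 2) with hr
  have hrsq : ∀ z, r z ^ 2 = ∑ i, z i ^ 2 := fun z =>
    Real.sq_sqrt (Finset.sum_nonneg fun _ _ => sq_nonneg _)
  have hr0 : ∀ z, 0 ≤ r z := fun z => Real.sqrt_nonneg _
  have hr1 : ∀ z, ‖z‖ ≤ r z := fun z => by
    refine (pi_norm_le_iff_of_nonneg (hr0 z)).2 fun i => ?_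
    refine Real.le_sqrt_of_sq_le ?_
    rw [Real.norm_eq_abs, sq_abs]
    exact Finset.single_le_sum (f := fun i => z i ^ 2) (fun _ _ => sq_nonneg _) (Finset.mem_univ i)
  have hr2 : ∀ z, r z ≤ m * ‖z‖ := fun z => by
    refine Real.sqrt_le_iff.2 ⟨by positivity, ?_⟩
    have : ∑ i, z i ^ 2 ≤ ∑ _i : Fin m, ‖z‖ ^ 2 := Finset.sum_le_sum fun i _ => by
      rw [← sq_abs]
      exact pow_le_pow_left₀ (abs_nonneg _) (norm_le_pi_norm z i) 2
    rw [Finset.sum_const, Finset.card_univ, Fintype.card_fin, nsmul_eq_mul] at this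
    have hmm : (0 : ℝ) ≤ m * (m - 1) := mul_nonneg (by linarith) (by linarith)
    nlinarith [mul_nonneg hmm (sq_nonneg ‖z‖)]
  set H : (Fin (m + 1) → ℝ) → ℝ≥0∞ := (lCone (m + 1)).indicator fun x => ENNReal.ofReal
    (lDelta (m + 1) (Fin.cons 1 0 + x) ^ (-t) * lDelta (m + 1) x ^ a) with hH
  have hΔ : Measurable (lDelta (m + 1)) := (continuous_lDelta _).measurable
  have hHm : Measurable H := by
    refine Measurable.indicator ?_ (measurableSet_lCone _)
    exact (((hΔ.comp (measurable_const_add _)).pow_const _).mul (hΔ.pow_const _)).ennreal_ofReal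
  have hF : coneBeta (m + 1) a t (Fin.cons 1 0) =
      ∫⁻ z : Fin m → ℝ, ∫⁻ s : ℝ, H (Fin.cons (s + r z) z) := by
    unfold coneBeta
    rw [← lintegral_indicator (measurableSet_lCone _), ← hH]
    have mp := (volume_preserving_piFinSuccAbove (fun _ : Fin (m + 1) => ℝ) 0).symm
    rw [← mp.lintegral_comp hHm, Measure.volume_eq_prod, lintegral_prod_symm']
    · refine lintegral_congr fun z => ?_
      rw [lintegral_add_right_eq_self (fun u : ℝ => H (Fin.cons u z))]
      refine lintegral_congr fun u => ?_
      congr 1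
      simp [MeasurableEquiv.piFinSuccAbove, Fin.insertNthEquiv]
    · exact hHm.comp (MeasurableEquiv.measurable _)
  have hnm : MeasurableSet {z : Fin m → ℝ | 1 < ‖z‖} :=
    measurableSet_lt measurable_const measurable_norm
  rw [hF, ← lintegral_const_mul' _ _ ENNReal.ofReal_ne_top, ← lintegral_mul_const,
    ← lintegral_indicator hnm]
  · refine lintegral_mono fun z => ?_
    by_cases hz : z ∈ {z : Fin m → ℝ | 1 < ‖z‖}
    swap
    · simp [Set.indicator_of_notMem hz]
    rw [Set.indicator_of_mem hz, ← lintegral_const_mul', ← lintegral_indicator measurableSet_Ioo]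
    · refine lintegral_mono fun s => ?_
      by_cases hs : s ∈ Set.Ioo (0 : ℝ) 1
      swap
      · simp [Set.indicator_of_notMem hs]
      simp only [Set.mem_ofPred_eq] at hz
      obtain ⟨hs0, hs1⟩ := hs
      have hN : 0 < ‖z‖ := by linarith
      have e1 : lDelta (m + 1) (Fin.cons (s + r z) z) = s * (2 * r z + s) := by
        rw [lDelta_cons, ← hrsq]; ring
      have e2 : lDelta (m + 1) (Fin.cons 1 0 + Fin.cons (s + r z) z) =
          (s + 1) * (2 * r z + s + 1) := by
        have : (Fin.cons 1 0 + Fin.cons (s + r z) z : Fin (m + 1) → ℝ) =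
            Fin.cons (1 + (s + r z)) z := by
          ext i
          refine Fin.cases ?_ (fun j => ?_) i <;> simp
        rw [this, lDelta_cons, ← hrsq]; ring
      have hz1 := hr1 z
      have hz2 := hr2 z
      have hmN : ‖z‖ ≤ m * ‖z‖ := by nlinarith
      have hcone : (Fin.cons (s + r z) z : Fin (m + 1) → ℝ) ∈ lCone (m + 1) := by
        refine ⟨?_, ?_⟩
        · rw [e1]; have := hr0 z; positivity
        · simp only [Fin.cons_zero]; linarith
      rw [Set.indicator_of_mem (show s ∈ Set.Ioo (0 : ℝ) 1 from ⟨hs0, hs1⟩), hH,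
        Set.indicator_of_mem hcone, e1, e2, ← ENNReal.ofReal_mul (by positivity),
        ← ENNReal.ofReal_mul (by positivity)]
      refine ENNReal.ofReal_le_ofReal ?_
      have k0 : s * (2 * r z + s) ≤ s * (3 * (m * ‖z‖)) :=
        mul_le_mul_of_nonneg_left (by linarith) hs0.le
      have k1 := h₁ ((s + 1) * (2 * r z + s + 1)) ‖z‖ hN (by nlinarith) (by nlinarith)
      have k2 := h₂ (s * (2 * r z + s)) (s * ‖z‖) (by positivity) (by nlinarith)
        (by nlinarith)
      calc c₁ * c₂ * ‖z‖ ^ (a - t) * s ^ a = (c₁ * ‖z‖ ^ (-t)) * (c₂ * (s * ‖z‖) ^ a) := by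
            rw [Real.mul_rpow hs0.le hN.le, sub_eq_add_neg, Real.rpow_add hN]; ring
        _ ≤ _ := mul_le_mul k1 k2 (by positivity) (le_trans (by positivity) k1)
    · exact ENNReal.mul_ne_top ENNReal.ofReal_ne_top ENNReal.ofReal_ne_top
  · exact ((measurable_norm.pow_const _).ennreal_ofReal).const_mul _

lemma lintegral_Ioo_rpow_pos (a : ℝ) :
    (∫⁻ s in Set.Ioo (0 : ℝ) 1, ENNReal.ofReal (s ^ a)) ≠ 0 := by
  refine ne_of_gt ((setLIntegral_pos_iff (by fun_prop)).2 ?_)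
  refine lt_of_lt_of_le (b := volume (Set.Ioo (0 : ℝ) 1)) (by simp)
    (measure_mono fun s hs => ⟨?_, hs⟩)
  simpa using Real.rpow_pos_of_pos hs.1 a

lemma lintegral_norm_rpow_pos (m : ℕ) (hm : 0 < m) (b : ℝ) :
    (∫⁻ z in {z : Fin m → ℝ | 1 < ‖z‖}, ENNReal.ofReal (‖z‖ ^ b)) ≠ 0 := by
  refine ne_of_gt ((setLIntegral_pos_iff (by fun_prop)).2 ?_)
  have : Nonempty (Fin m) := ⟨⟨0, hm⟩⟩
  refine lt_of_lt_of_le (b := volume {z : Fin m → ℝ | 1 < ‖z‖}) ?_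
    (measure_mono fun z hz => ⟨?_, hz⟩)
  · refine (isOpen_lt continuous_const continuous_norm).measure_pos _ ⟨fun _ => 2, ?_⟩
    simp
  · have : 0 < ‖z‖ := one_pos.trans hz
    simpa using Real.rpow_pos_of_pos this b

lemma neg_one_lt_of_lintegral_Ioo_rpow (a : ℝ)
    (h : (∫⁻ s in Set.Ioo (0 : ℝ) 1, ENNReal.ofReal (s ^ a)) ≠ ⊤) : -1 < a := by
  rw [← intervalIntegral.integrableOn_Ioo_rpow_iff one_pos]
  refine ⟨by fun_prop, ?_⟩
  rw [hasFiniteIntegral_iff_ofReal]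
  · exact h.lt_top
  · exact ae_restrict_of_forall_mem measurableSet_Ioo fun s hs => Real.rpow_nonneg hs.1.le _

lemma lt_neg_of_lintegral_norm_rpow (m : ℕ) (hm : 0 < m) (b : ℝ)
    (h : (∫⁻ z in {z : Fin m → ℝ | 1 < ‖z‖}, ENNReal.ofReal (‖z‖ ^ b)) ≠ ⊤) : b < -m := by
  have : Nonempty (Fin m) := ⟨⟨0, hm⟩⟩
  have hnm : MeasurableSet {z : Fin m → ℝ | 1 < ‖z‖} :=
    measurableSet_lt measurable_const measurable_norm
  have h1 : Integrable (fun z : Fin m → ℝ => (Set.Ioi (1 : ℝ)).indicator (· ^ b) ‖z‖) := by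
    have h0 : IntegrableOn (fun z : Fin m → ℝ => ‖z‖ ^ b) {z | 1 < ‖z‖} := by
      refine ⟨(measurable_norm.pow_const b).aestronglyMeasurable, ?_⟩
      rw [hasFiniteIntegral_iff_ofReal (ae_of_all _ fun z => by positivity)]
      exact h.lt_top
    rw [← integrable_indicator_iff hnm] at h0
    exact h0
  rw [integrable_fun_norm_addHaar, Module.finrank_fin_fun] at h1
  have h2 : IntegrableOn (fun x : ℝ => x ^ ((m : ℝ) - 1 + b)) (Set.Ioi 1) := by
    refine (h1.mono_set (Set.Ioi_subset_Ioi zero_le_one)).congr_fun (fun x hx => ?_)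
      measurableSet_Ioi
    have hx0 : (0 : ℝ) < x := one_pos.trans hx
    simp only [Set.indicator_of_mem hx, smul_eq_mul]
    rw [Real.rpow_add hx0, ← Real.rpow_natCast, Nat.cast_sub hm, Nat.cast_one]
  rw [integrableOn_Ioi_rpow_iff one_pos] at h2
  linarith

lemma eq_zero_of_forall_rpow_le {e D : ℝ} (h : ∀ τ : ℝ, 0 < τ → τ ^ e ≤ D) : e = 0 := by
  by_contra he
  have hD : 0 < D := lt_of_lt_of_le (by norm_num) (h 1 one_pos)
  have := h ((D + 1) ^ e⁻¹) (by positivity)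
  rw [← Real.rpow_mul (by positivity), inv_mul_cancel₀ he, Real.rpow_one] at this
  linarith

/-- Lemma 4.6 of the paper on the rank-2 Lorentz cone (necessity, target `L^∞`). -/
theorem statement15 (n : ℕ) [NeZero n] (hn : 3 ≤ n) (α β γ ν p : ℝ)
    (hp : 1 < p)
    (hS : SBoundedSup n α β γ p ν) :
    γ = α + β + (n : ℝ) / 2 - ν / p ∧
      ν < p * (β + 1) + (n : ℝ) / 2 - 1 ∧
      p * (α - (n : ℝ) / 2 + 1) > -((n : ℝ) / 2) + 1 := by
  obtain ⟨m, rfl⟩ := Nat.exists_eq_succ_of_ne_zero (NeZero.ne n)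
  have hm : 0 < m := by omega
  have hp1 : 0 < p - 1 := by linarith
  obtain ⟨D, hD⟩ := coneBeta_le_of_sBoundedSup _ hp hS
  set a := β * (p / (p - 1)) - (ν - (m.succ : ℕ) / 2) * (1 / (p - 1)) with ha
  set t := γ * (p / (p - 1)) with ht
  set y : Fin (m + 1) → ℝ := Fin.cons 1 0 with hy
  have hΔy : lDelta (m + 1) y = 1 := by simp [hy, lDelta_cons]
  have hyc : y ∈ lCone (m + 1) := ⟨by rw [hΔy]; exact one_pos, by simp [hy]⟩
  obtain ⟨c, hc, hlow⟩ := exists_mul_le_coneBeta m hm a t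
  rw [← hy] at hlow
  have hfin : coneBeta (m + 1) a t y ≠ ⊤ := ne_top_of_le_ne_top ENNReal.ofReal_ne_top (hD y hyc)
  have hA := lintegral_norm_rpow_pos m hm (a - t)
  have hB := lintegral_Ioo_rpow_pos a
  have hc' : ENNReal.ofReal c ≠ 0 := (ENNReal.ofReal_pos.2 hc).ne'
  have hprod := ne_top_of_le_ne_top hfin hlow
  have hpos : coneBeta (m + 1) a t y ≠ 0 :=
    ne_of_gt (lt_of_lt_of_le (pos_iff_ne_zero.2 (mul_ne_zero (mul_ne_zero hc' hA) hB)) hlow)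
  have i2 : -1 < a := by
    refine neg_one_lt_of_lintegral_Ioo_rpow a fun htop => hprod ?_
    rw [htop, ENNReal.mul_top (mul_ne_zero hc' hA)]
  have i3 : a - t < -m := by
    refine lt_neg_of_lintegral_norm_rpow m hm _ fun htop => hprod ?_
    rw [htop, ENNReal.mul_top hc', ENNReal.top_mul hB]
  have i1 : 2 * a - 2 * t + (m + 1 : ℕ) + 2 * α * (p / (p - 1)) = 0 := by
    set K := (coneBeta (m + 1) a t y).toReal with hK
    have hK0 : 0 < K := ENNReal.toReal_pos hpos hfin
    have hKe : coneBeta (m + 1) a t y = ENNReal.ofReal K := (ENNReal.ofReal_toReal hfin).symm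
    refine eq_zero_of_forall_rpow_le (D := max D 0 / K) fun τ hτ => ?_
    have : coneBeta (m + 1) a t (τ • y) ≤
        ENNReal.ofReal (D * lDelta (m + 1) (τ • y) ^ (-α * (p / (p - 1)))) :=
      hD (τ • y) ((smul_mem_lCone hτ).2 hyc)
    rw [coneBeta_smul _ _ _ hτ hyc, hKe, lDelta_smul, hΔy, mul_one,
      ← ENNReal.ofReal_mul (by positivity), ← Real.rpow_natCast, ← Real.rpow_mul hτ.le] at this
    have h2 := this.trans (ENNReal.ofReal_le_ofReal (mul_le_mul_of_nonneg_right (le_max_left D 0)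
      (by positivity)))
    rw [ENNReal.ofReal_le_ofReal_iff (by positivity)] at h2
    rw [Real.rpow_add hτ, le_div_iff₀ hK0]
    have h3 : τ ^ (((2 : ℕ) : ℝ) * (-α * (p / (p - 1)))) * τ ^ (2 * α * (p / (p - 1))) = 1 := by
      rw [← Real.rpow_add hτ]
      convert Real.rpow_zero τ using 2
      push_cast
      ring
    have h4 := mul_le_mul_of_nonneg_right h2 (Real.rpow_nonneg hτ.le (2 * α * (p / (p - 1))))
    rw [mul_assoc (max D 0), h3] at h4
    linarith
  rw [ha] at i1 i2 i3
  rw [ht] at i1 i3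
  simp only [Nat.succ_eq_add_one, Nat.cast_add, Nat.cast_one] at i1 i2 i3 ⊢
  have e1 : γ = α + β + ((m : ℝ) + 1) / 2 - ν / p := by
    field_simp at i1 ⊢
    linarith
  refine ⟨e1, ?_, ?_⟩
  · have h := mul_lt_mul_of_pos_right i2 hp1
    field_simp at h
    linarith
  · have h := mul_lt_mul_of_pos_right i3 hp1
    rw [e1] at h
    field_simp at h
    linarith
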